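/- Let X be a complex Banach space and let T : ℂ → (X →L[ℂ] X) be a family of bounded linear operators that is analytic at ε = 0. Let G ⊆ ℂ be an open, bounded set whose closure is contained in the resolvent set of T(0). Then there exists ε₀ > 0 such that for every ε ∈ ℂ with |ε| < ε₀, the set G is contained in the resolvent set of T(ε). -/

import Mathlib

open Metric

/-- Spectral stability for analytic families of bounded operators: if `G` is an open
bounded set whose closure lies in the resolvent set of `T 0`, then `G` lies in the
resolvent set of `T ε` for all sufficiently small `ε`. -/
theorem resolvent_set_stable_under_analytic_perturbation
    {X : Type*} [NormedAddCommGroup X] [NormedSpace ℂ X] [CompleteSpace X]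
    (T : ℂ → (X →L[ℂ] X)) (hT : AnalyticAt ℂ T 0)
    (G : Set ℂ) (hG_open : IsOpen G) (hG_bdd : Bornology.IsBounded G)
    (hG_res : closure G ⊆ resolventSet ℂ (T 0)) :
    ∃ ε₀ : ℝ, 0 < ε₀ ∧ ∀ ε : ℂ, ‖ε‖ < ε₀ → G ⊆ resolventSet ℂ (T ε) := by
  have hK : IsCompact (closure G) := hG_bdd.isCompact_closure
  have h : ∀ᶠ ε in nhds (0 : ℂ), ∀ z ∈ closure G, z ∈ resolventSet ℂ (T ε) := by
    refine hK.eventually_forall_of_forall_eventually fun z hz => ?_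
    have hcont : ContinuousAt
        (fun p : ℂ × ℂ => algebraMap ℂ (X →L[ℂ] X) p.2 - T p.1) (0, z) :=
      ((algebraMapCLM ℂ (X →L[ℂ] X)).continuous.comp continuous_snd).continuousAt.sub
        (ContinuousAt.comp (f := Prod.fst) (x := ((0, z) : ℂ × ℂ)) hT.continuousAt
          continuousAt_fst)
    exact hcont.eventually (Units.isOpen.mem_nhds (hG_res hz))
  obtain ⟨ε₀, hpos, hε₀⟩ := Metric.eventually_nhds_iff.mp h
  exact ⟨ε₀, hpos, fun ε hε z hz =>
    hε₀ (by rwa [dist_zero_right]) z (subset_closure hz)⟩
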